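/- Let n ≥ 1 and let λ be a positive integer with λ > n. Let g be a complex (n+1)×(n+1) matrix with gᴴ J g = J. Let φ : 𝔹ⁿ → ℂ be bounded and continuous and let f : 𝔹ⁿ → ℂ be bounded and holomorphic. Then for every z ∈ 𝔹ⁿ, d_{g⁻¹}(z)^{−λ} · ∫_{𝔹ⁿ} φ(w) f(w) (1 − ⟨g⁻¹·z, w⟩)^{−λ} dμ_λ(w) = ∫_{𝔹ⁿ} φ(g⁻¹·w) d_{g⁻¹}(w)^{−λ} f(g⁻¹·w) (1 − ⟨z, w⟩)^{−λ} dμ_λ(w), both integrals converging absolutely. (That is, π_λ(g) ∘ T_φ^{(λ)} = T_{φ_g}^{(λ)} ∘ π_λ(g), where π_λ(g)f(z) = d_{g⁻¹}(z)^{−λ} f(g⁻¹·z) and φ_g(z) = φ(g⁻¹·z).) -/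

import Mathlib

open MeasureTheory Complex

noncomputable section

/-- The open unit ball in ℂⁿ. -/
def UnitBall (n : ℕ) : Set (Fin n → ℂ) := {z | ∑ i, ‖z i‖ ^ 2 < 1}

/-- The density of the weighted measure μ_λ with respect to Lebesgue measure. -/
def bergWeight (n : ℕ) (lam : ℝ) (z : Fin n → ℂ) : ℝ :=
  Real.Gamma lam / (Real.pi ^ n * Real.Gamma (lam - n)) *
    (1 - ∑ i, ‖z i‖ ^ 2) ^ (lam - n - 1)

/-- The weighted measure μ_λ on the unit ball. -/
def bergMeasure (n : ℕ) (lam : ℝ) : Measure (Fin n → ℂ) :=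
  (volume.restrict (UnitBall n)).withDensity fun z => ENNReal.ofReal (bergWeight n lam z)

/-- The matrix J = diag(1,…,1,−1). -/
def Jmat (n : ℕ) : Matrix (Fin (n + 1)) (Fin (n + 1)) ℂ :=
  Matrix.diagonal fun i => if i = Fin.last n then -1 else 1

/-- ζ_z = (z, 1) ∈ ℂ^{n+1}. -/
def zeta (n : ℕ) (z : Fin n → ℂ) : Fin (n + 1) → ℂ := Fin.snoc z 1

/-- d_g(z): the last coordinate of g ζ_z. -/
def dCoc (n : ℕ) (g : Matrix (Fin (n + 1)) (Fin (n + 1)) ℂ) (z : Fin n → ℂ) : ℂ :=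
  g.mulVec (zeta n z) (Fin.last n)

/-- The Möbius action g·z = ((gζ_z)₁,…,(gζ_z)_n)/d_g(z). -/
def mob (n : ℕ) (g : Matrix (Fin (n + 1)) (Fin (n + 1)) ℂ) (z : Fin n → ℂ) :
    Fin n → ℂ :=
  fun i => g.mulVec (zeta n z) i.castSucc / dCoc n g z

/-- Hermitian pairing ⟨z,w⟩ = Σ zᵢ conj(wᵢ). -/
def herm (n : ℕ) (z w : Fin n → ℂ) : ℂ := ∑ i, z i * (starRingEnd ℂ) (w i)

/-- The `J`-form evaluated on the lifts of `z` and `w`. -/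
theorem star_zeta_dotProduct_Jmat (n : ℕ) (z w : Fin n → ℂ) :
    star (zeta n w) ⬝ᵥ (Jmat n).mulVec (zeta n z) = herm n z w - 1 := by
  simp [dotProduct, Jmat, Matrix.mulVec_diagonal, Fin.sum_univ_castSucc, zeta, herm,
    Fin.castSucc_ne_last, mul_comm, sub_eq_add_neg]

theorem star_mulVec_dotProduct_Jmat {n : ℕ} {h : Matrix (Fin (n + 1)) (Fin (n + 1)) ℂ}
    (hh : h.conjTranspose * Jmat n * h = Jmat n) (x y : Fin (n + 1) → ℂ) :
    star (h.mulVec y) ⬝ᵥ (Jmat n).mulVec (h.mulVec x) = star y ⬝ᵥ (Jmat n).mulVec x := by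
  rw [Matrix.star_mulVec, ← Matrix.dotProduct_mulVec, Matrix.mulVec_mulVec, Matrix.mulVec_mulVec,
    hh]

theorem norm_det_eq_one_of_Jmat {n : ℕ} {h : Matrix (Fin (n + 1)) (Fin (n + 1)) ℂ}
    (hh : h.conjTranspose * Jmat n * h = Jmat n) : ‖h.det‖ = 1 := by
  have hJ : (Jmat n).det ≠ 0 := by
    rw [Jmat, Matrix.det_diagonal, Finset.prod_ne_zero_iff]
    intro i _
    split_ifs <;> simp
  have h1 := congrArg (fun A => ‖Matrix.det A‖) hh
  simp only [Matrix.det_mul, Matrix.det_conjTranspose, norm_mul, norm_star] at h1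
  have h2 : ‖(Jmat n).det‖ ≠ 0 := norm_ne_zero_iff.2 hJ
  have h3 : ‖h.det‖ * ‖h.det‖ = 1 := by
    apply mul_right_cancel₀ h2
    linear_combination h1
  nlinarith [norm_nonneg h.det]

theorem conjTranspose_inv_mul_Jmat {n : ℕ} {g : Matrix (Fin (n + 1)) (Fin (n + 1)) ℂ}
    (hg : g.conjTranspose * Jmat n * g = Jmat n) :
    (g⁻¹).conjTranspose * Jmat n * g⁻¹ = Jmat n := by
  have hu : IsUnit g.det := by
    have := norm_det_eq_one_of_Jmat hg
    exact isUnit_iff_ne_zero.2 (norm_ne_zero_iff.1 (by rw [this]; exact one_ne_zero))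
  have h1 : g * g⁻¹ = 1 := Matrix.mul_nonsing_inv g hu
  have h2 : (g⁻¹).conjTranspose * g.conjTranspose = 1 := by
    rw [← Matrix.conjTranspose_mul, h1, Matrix.conjTranspose_one]
  calc (g⁻¹).conjTranspose * Jmat n * g⁻¹
      = (g⁻¹).conjTranspose * (g.conjTranspose * Jmat n * g) * g⁻¹ := by rw [hg]
    _ = ((g⁻¹).conjTranspose * g.conjTranspose) * Jmat n * (g * g⁻¹) := by
        simp only [Matrix.mul_assoc]
    _ = Jmat n := by rw [h1, h2, Matrix.one_mul, Matrix.mul_one]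

theorem herm_self (n : ℕ) (z : Fin n → ℂ) : herm n z z = ((∑ i, ‖z i‖ ^ 2 : ℝ) : ℂ) := by
  simp [herm, Complex.mul_conj']

theorem mulVec_zeta (n : ℕ) (h : Matrix (Fin (n + 1)) (Fin (n + 1)) ℂ) (z : Fin n → ℂ)
    (hd : dCoc n h z ≠ 0) : h.mulVec (zeta n z) = dCoc n h z • zeta n (mob n h z) := by
  ext i
  refine Fin.lastCases ?_ (fun i => ?_) i
  · simp [zeta, dCoc]
  · simp only [Pi.smul_apply, zeta, Fin.snoc_castSucc, mob, smul_eq_mul]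
    field_simp

theorem dCoc_mul_conj_mul_one_sub_herm {n : ℕ} {h : Matrix (Fin (n + 1)) (Fin (n + 1)) ℂ}
    (hh : h.conjTranspose * Jmat n * h = Jmat n) {z w : Fin n → ℂ}
    (hz : dCoc n h z ≠ 0) (hw : dCoc n h w ≠ 0) :
    dCoc n h z * (starRingEnd ℂ) (dCoc n h w) * (1 - herm n (mob n h z) (mob n h w)) =
      1 - herm n z w := by
  have h1 := star_mulVec_dotProduct_Jmat hh (zeta n z) (zeta n w)
  rw [mulVec_zeta n h z hz, mulVec_zeta n h w hw, star_smul, Matrix.mulVec_smul, smul_dotProduct,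
    dotProduct_smul, star_zeta_dotProduct_Jmat, star_zeta_dotProduct_Jmat] at h1
  simp only [smul_eq_mul, Complex.star_def] at h1
  linear_combination -h1

theorem dCoc_ne_zero {n : ℕ} {h : Matrix (Fin (n + 1)) (Fin (n + 1)) ℂ}
    (hh : h.conjTranspose * Jmat n * h = Jmat n) {z : Fin n → ℂ} (hz : z ∈ UnitBall n) :
    dCoc n h z ≠ 0 := by
  intro hd
  have h1 := star_mulVec_dotProduct_Jmat hh (zeta n z) (zeta n z)
  rw [star_zeta_dotProduct_Jmat, herm_self] at h1
  have hd' : h.mulVec (zeta n z) (Fin.last n) = 0 := hd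
  have h2 : star (h.mulVec (zeta n z)) ⬝ᵥ (Jmat n).mulVec (h.mulVec (zeta n z)) =
      ((∑ i : Fin n, ‖h.mulVec (zeta n z) i.castSucc‖ ^ 2 : ℝ) : ℂ) := by
    rw [dotProduct, Fin.sum_univ_castSucc]
    simp [Jmat, Matrix.mulVec_diagonal, hd', Fin.castSucc_ne_last, Complex.conj_mul']
  rw [h2] at h1
  have h3 : (∑ i : Fin n, ‖h.mulVec (zeta n z) i.castSucc‖ ^ 2 : ℝ) = ∑ i, ‖z i‖ ^ 2 - 1 := by
    exact_mod_cast h1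
  have h4 : (0 : ℝ) ≤ ∑ i : Fin n, ‖h.mulVec (zeta n z) i.castSucc‖ ^ 2 := by positivity
  have h5 : ∑ i, ‖z i‖ ^ 2 < 1 := hz
  linarith

theorem norm_dCoc_sq_mul {n : ℕ} {h : Matrix (Fin (n + 1)) (Fin (n + 1)) ℂ}
    (hh : h.conjTranspose * Jmat n * h = Jmat n) {z : Fin n → ℂ} (hz : z ∈ UnitBall n) :
    ‖dCoc n h z‖ ^ 2 * (1 - ∑ i, ‖mob n h z i‖ ^ 2) = 1 - ∑ i, ‖z i‖ ^ 2 := by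
  have hd := dCoc_ne_zero hh hz
  have h1 := dCoc_mul_conj_mul_one_sub_herm hh hd hd
  rw [herm_self, herm_self, Complex.mul_conj'] at h1
  exact_mod_cast h1

theorem mob_mem_unitBall {n : ℕ} {h : Matrix (Fin (n + 1)) (Fin (n + 1)) ℂ}
    (hh : h.conjTranspose * Jmat n * h = Jmat n) {z : Fin n → ℂ} (hz : z ∈ UnitBall n) :
    mob n h z ∈ UnitBall n := by
  have h1 := norm_dCoc_sq_mul hh hz
  have h2 : 0 < ‖dCoc n h z‖ ^ 2 := by have := dCoc_ne_zero hh hz; positivity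
  have h3 : ∑ i, ‖z i‖ ^ 2 < 1 := hz
  have h4 : 0 < 1 - ∑ i, ‖mob n h z i‖ ^ 2 := pos_of_mul_pos_right (by linarith) h2.le
  change ∑ i, ‖mob n h z i‖ ^ 2 < 1
  linarith

theorem mob_mob_of_mul_eq_one {n : ℕ} {g h : Matrix (Fin (n + 1)) (Fin (n + 1)) ℂ}
    (hgh : g * h = 1) {z : Fin n → ℂ} (hd : dCoc n h z ≠ 0) : mob n g (mob n h z) = z := by
  have h1 : dCoc n h z • g.mulVec (zeta n (mob n h z)) = zeta n z := by
    rw [← Matrix.mulVec_smul, ← mulVec_zeta n h z hd, Matrix.mulVec_mulVec, hgh, Matrix.one_mulVec]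
  have h2 (k) : g.mulVec (zeta n (mob n h z)) k = zeta n z k / dCoc n h z := by
    rw [← h1, Pi.smul_apply, smul_eq_mul, mul_div_cancel_left₀ _ hd]
  ext i
  simp only [mob, dCoc] at h2 ⊢
  rw [h2, h2]
  simp only [zeta, Fin.snoc_castSucc, Fin.snoc_last]
  have : h.mulVec (Fin.snoc z 1) (Fin.last n) ≠ 0 := hd
  field_simp

/-- The complex Jacobian matrix of the Möbius action. -/
def mobJacobian (n : ℕ) (h : Matrix (Fin (n + 1)) (Fin (n + 1)) ℂ) (z : Fin n → ℂ) :
    Matrix (Fin n) (Fin n) ℂ :=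
  Matrix.of fun i j =>
    (dCoc n h z)⁻¹ * (h i.castSucc j.castSucc - mob n h z i * h (Fin.last n) j.castSucc)

theorem hasFDerivAt_mulVec_zeta (n : ℕ) (h : Matrix (Fin (n + 1)) (Fin (n + 1)) ℂ)
    (z : Fin n → ℂ) (k : Fin (n + 1)) :
    HasFDerivAt (fun z => h.mulVec (zeta n z) k)
      (∑ j : Fin n, h k j.castSucc • ContinuousLinearMap.proj (R := ℂ) (φ := fun _ => ℂ) j) z := by
  have h1 : (fun z => h.mulVec (zeta n z) k) =
      fun z => ∑ j : Fin n, h k j.castSucc * z j + h k (Fin.last n) := by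
    ext z
    simp [Matrix.mulVec, dotProduct, Fin.sum_univ_castSucc, zeta]
  rw [h1]
  refine HasFDerivAt.add_const _ (HasFDerivAt.fun_sum fun j _ => ?_)
  exact (ContinuousLinearMap.proj (R := ℂ) (φ := fun _ => ℂ) j).hasFDerivAt.const_mul _

theorem hasFDerivAt_mob {n : ℕ} {h : Matrix (Fin (n + 1)) (Fin (n + 1)) ℂ} {z : Fin n → ℂ}
    (hd : dCoc n h z ≠ 0) :
    HasFDerivAt (mob n h) (Matrix.toLin' (mobJacobian n h z)).toContinuousLinearMap z := by
  refine hasFDerivAt_pi'' fun i => ?_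
  have h1 := (hasFDerivAt_mulVec_zeta n h z i.castSucc).mul
    ((hasFDerivAt_inv hd).comp z (hasFDerivAt_mulVec_zeta n h z (Fin.last n)))
  refine h1.congr_fderiv ?_
  ext v
  have hN : h.mulVec (zeta n z) i.castSucc = mob n h z i * dCoc n h z :=
    (div_mul_cancel₀ _ hd).symm
  rw [hN]
  simp only [mobJacobian, Matrix.mulVec_eq_sum, add_apply, smul_apply, sum_apply,
    ContinuousLinearMap.comp_apply, ContinuousLinearMap.toSpanSingleton_apply,
    ContinuousLinearMap.proj_apply, smul_eq_mul, Function.comp_apply,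
    LinearMap.coe_toContinuousLinearMap', Matrix.toLin'_apply, Finset.sum_apply, Pi.smul_apply,
    Matrix.transpose_apply, Matrix.of_apply, MulOpposite.smul_eq_mul_unop, MulOpposite.unop_op,
    Finset.sum_mul, Finset.mul_sum, ← Finset.sum_add_distrib]
  refine Finset.sum_congr rfl fun j _ => ?_
  field_simp
  ring

theorem det_mobJacobian {n : ℕ} {h : Matrix (Fin (n + 1)) (Fin (n + 1)) ℂ} {z : Fin n → ℂ}
    (hd : dCoc n h z ≠ 0) :
    (mobJacobian n h z).det * dCoc n h z ^ (n + 1) = h.det := by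
  set A := h.updateCol (Fin.last n) (fun k => ∑ i, zeta n z i • h k i) with hA
  have hAdet : A.det = h.det := by
    rw [hA, Matrix.det_updateCol_sum]
    simp [zeta]
  have hcol (k) : A k (Fin.last n) = h.mulVec (zeta n z) k := by
    simp [hA, Matrix.mulVec, dotProduct, mul_comm]
  have hcast (k) (j : Fin n) : A k j.castSucc = h k j.castSucc := by
    simp [hA, Fin.castSucc_ne_last]
  set c : Fin (n + 1) → ℂ := Fin.snoc (mob n h z) 0 with hc
  set B : Matrix (Fin (n + 1)) (Fin (n + 1)) ℂ :=
    Matrix.of fun i j => A i j - c i * A (Fin.last n) j with hB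
  have hBlast (j) : B (Fin.last n) j = A (Fin.last n) j := by simp [hB, hc]
  have hAB : A.det = B.det :=
    Matrix.det_eq_of_forall_row_eq_smul_add_const c (Fin.last n) (by simp [hc])
      (fun i j => by rw [hBlast]; simp [hB])
  have hBcol (i : Fin n) : B i.castSucc (Fin.last n) = 0 := by
    simp only [hB, Matrix.of_apply, hcol, hc, Fin.snoc_castSucc, mob]
    change _ - _ / dCoc n h z * dCoc n h z = 0
    rw [div_mul_cancel₀ _ hd, sub_self]
  have hBsub : B.submatrix Fin.castSucc Fin.castSucc = dCoc n h z • mobJacobian n h z := by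
    ext i j
    simp [hB, hcast, hc, mobJacobian, hd]
  rw [← hAdet, hAB, Matrix.det_succ_column B (Fin.last n), Fin.sum_univ_castSucc]
  simp only [hBcol, Fin.succAbove_last, hBsub, hBlast, hcol, Matrix.det_smul, Fintype.card_fin]
  simp only [mul_zero, zero_mul, Finset.sum_const_zero, zero_add, ← two_mul, pow_mul]
  change _ = _ * dCoc n h z * _
  simp
  ring

theorem abs_det_mobJacobian {n : ℕ} {h : Matrix (Fin (n + 1)) (Fin (n + 1)) ℂ}
    (hh : h.conjTranspose * Jmat n * h = Jmat n) {z : Fin n → ℂ} (hz : z ∈ UnitBall n) :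
    |((Matrix.toLin' (mobJacobian n h z)).toContinuousLinearMap.restrictScalars ℝ).det| =
      ((‖dCoc n h z‖ ^ 2) ^ (n + 1))⁻¹ := by
  have hd := dCoc_ne_zero hh hz
  have h1 : ((Matrix.toLin' (mobJacobian n h z)).toContinuousLinearMap.restrictScalars ℝ).det =
      ‖(mobJacobian n h z).det‖ ^ 2 := by
    have := LinearMap.det_restrictScalars (R := ℝ) (f := Matrix.toLin' (mobJacobian n h z))
    rw [LinearMap.det_toLin', Algebra.norm_complex_apply, Complex.normSq_eq_norm_sq] at this
    exact this
  have h2 := congrArg norm (det_mobJacobian hd (h := h))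
  rw [norm_det_eq_one_of_Jmat hh, norm_mul, norm_pow] at h2
  rw [h1, abs_of_nonneg (by positivity), ← pow_mul, mul_comm 2, pow_mul, ← inv_pow,
    eq_inv_of_mul_eq_one_left h2]

theorem isOpen_unitBall (n : ℕ) : IsOpen (UnitBall n) :=
  isOpen_lt (by fun_prop) continuous_const

theorem measurable_bergWeight (n : ℕ) (lam : ℝ) : Measurable (bergWeight n lam) := by
  unfold bergWeight
  fun_prop

theorem bergWeight_nonneg {n : ℕ} {lam : ℝ} (hlam : n < lam) {w : Fin n → ℂ}
    (hw : w ∈ UnitBall n) : 0 ≤ bergWeight n lam w := by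
  have h1 : ∑ i, ‖w i‖ ^ 2 < 1 := hw
  have h2 : 0 < Real.Gamma (lam - n) := Real.Gamma_pos_of_pos (by linarith)
  have h3 : 0 < Real.Gamma lam := Real.Gamma_pos_of_pos ((Nat.cast_nonneg n).trans_lt hlam)
  have h4 : 0 ≤ 1 - ∑ i, ‖w i‖ ^ 2 := by linarith
  have := Real.pi_pos
  unfold bergWeight
  positivity

theorem integrable_bergMeasure_iff {n : ℕ} {lam : ℝ} (hlam : n < lam) (F : (Fin n → ℂ) → ℂ) :
    Integrable F (bergMeasure n lam) ↔
      IntegrableOn (fun w => bergWeight n lam w • F w) (UnitBall n) := by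
  refine (integrable_withDensity_iff_integrable_smul
    (measurable_bergWeight n lam).real_toNNReal).trans (integrable_congr ?_)
  filter_upwards [ae_restrict_mem (isOpen_unitBall n).measurableSet] with w hw
  rw [NNReal.smul_def, Real.coe_toNNReal _ (bergWeight_nonneg hlam hw)]

theorem integral_bergMeasure {n : ℕ} {lam : ℝ} (hlam : n < lam) (F : (Fin n → ℂ) → ℂ) :
    ∫ w, F w ∂(bergMeasure n lam) = ∫ w in UnitBall n, bergWeight n lam w • F w := by
  refine (integral_withDensity_eq_integral_smul
    (measurable_bergWeight n lam).real_toNNReal F).trans (integral_congr_ae ?_)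
  filter_upwards [ae_restrict_mem (isOpen_unitBall n).measurableSet] with w hw
  rw [NNReal.smul_def, Real.coe_toNNReal _ (bergWeight_nonneg hlam hw)]

theorem bergWeight_natCast_le {n lam : ℕ} (hlam : n < lam) {w : Fin n → ℂ}
    (hw : w ∈ UnitBall n) :
    bergWeight n lam w ≤ Real.Gamma lam / (Real.pi ^ n * Real.Gamma ((lam : ℝ) - n)) := by
  have h1 : ∑ i, ‖w i‖ ^ 2 < 1 := hw
  have h0 : 0 ≤ ∑ i, ‖w i‖ ^ 2 := by positivity
  have hlam' : (n : ℝ) + 1 ≤ lam := by exact_mod_cast hlam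
  have h2 : 0 < Real.Gamma ((lam : ℝ) - n) := Real.Gamma_pos_of_pos (by linarith)
  have h3 : 0 < Real.Gamma (lam : ℝ) :=
    Real.Gamma_pos_of_pos (by linarith [(Nat.cast_nonneg n : (0 : ℝ) ≤ n)])
  have := Real.pi_pos
  exact mul_le_of_le_one_right (by positivity)
    (Real.rpow_le_one (by linarith) (by linarith) (by linarith))

theorem unitBall_subset_ball (n : ℕ) : UnitBall n ⊆ Metric.ball 0 1 := by
  intro w hw
  have h1 : ∑ i, ‖w i‖ ^ 2 < 1 := hw
  rw [mem_ball_zero_iff, pi_norm_lt_iff one_pos]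
  intro i
  have h2 : ‖w i‖ ^ 2 ≤ ∑ i, ‖w i‖ ^ 2 :=
    Finset.single_le_sum (f := fun i => ‖w i‖ ^ 2) (fun _ _ => by positivity) (Finset.mem_univ i)
  nlinarith [norm_nonneg (w i)]

theorem isFiniteMeasure_bergMeasure {n lam : ℕ} (hlam : n < lam) :
    IsFiniteMeasure (bergMeasure n lam) := by
  have hfin : volume (UnitBall n) < ⊤ :=
    (measure_mono (unitBall_subset_ball n)).trans_lt measure_ball_lt_top
  refine isFiniteMeasure_withDensity_ofReal (Integrable.hasFiniteIntegral ?_)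
  refine Measure.integrableOn_of_bounded hfin.ne
    (measurable_bergWeight n lam).aestronglyMeasurable ?_
    (M := Real.Gamma lam / (Real.pi ^ n * Real.Gamma ((lam : ℝ) - n)))
  filter_upwards [ae_restrict_mem (isOpen_unitBall n).measurableSet] with w hw
  rw [Real.norm_of_nonneg (bergWeight_nonneg (by exact_mod_cast hlam) hw)]
  exact bergWeight_natCast_le hlam hw

theorem ae_bergMeasure_mem (n : ℕ) (lam : ℝ) : ∀ᵐ w ∂(bergMeasure n lam), w ∈ UnitBall n :=
  (withDensity_absolutelyContinuous _ _).ae_le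
    (ae_restrict_mem (isOpen_unitBall n).measurableSet)

theorem norm_herm_le {n : ℕ} (a : Fin n → ℂ) {w : Fin n → ℂ} (hw : w ∈ UnitBall n) :
    ‖herm n a w‖ ≤ √(∑ i, ‖a i‖ ^ 2) := by
  have h1 : ∑ i, ‖w i‖ ^ 2 < 1 := hw
  calc ‖herm n a w‖ ≤ ∑ i, ‖a i‖ * ‖w i‖ := by
        refine (norm_sum_le _ _).trans_eq ?_
        simp
    _ ≤ √(∑ i, ‖a i‖ ^ 2) * √(∑ i, ‖w i‖ ^ 2) := Real.sum_mul_le_sqrt_mul_sqrt _ _ _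
    _ ≤ √(∑ i, ‖a i‖ ^ 2) :=
        mul_le_of_le_one_right (Real.sqrt_nonneg _) (Real.sqrt_le_one.2 h1.le)

theorem one_sub_sqrt_le_norm_one_sub_herm {n : ℕ} (a : Fin n → ℂ) {w : Fin n → ℂ}
    (hw : w ∈ UnitBall n) : 1 - √(∑ i, ‖a i‖ ^ 2) ≤ ‖1 - herm n a w‖ := by
  have h1 := norm_sub_norm_le 1 (herm n a w)
  rw [norm_one] at h1
  linarith [norm_herm_le a hw]

/-- Bounded continuous functions times the kernel at a point of the ball are integrable. -/
theorem integrable_mul_kernel {n lam : ℕ} (hlam : n < lam) {F : (Fin n → ℂ) → ℂ}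
    (hFc : ContinuousOn F (UnitBall n)) (hFb : ∃ C : ℝ, ∀ z ∈ UnitBall n, ‖F z‖ ≤ C)
    {a : Fin n → ℂ} (ha : a ∈ UnitBall n) :
    Integrable (fun w => F w * (1 - herm n a w) ^ (-(lam : ℤ))) (bergMeasure n lam) := by
  have := isFiniteMeasure_bergMeasure hlam
  obtain ⟨C, hC⟩ := hFb
  have ha' : √(∑ i, ‖a i‖ ^ 2) < 1 := by
    rw [Real.sqrt_lt' one_pos, one_pow]
    exact ha
  set δ := 1 - √(∑ i, ‖a i‖ ^ 2) with hδ
  have hδ0 : 0 < δ := by linarith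
  have hpos {w : Fin n → ℂ} (hw : w ∈ UnitBall n) : δ ≤ ‖1 - herm n a w‖ :=
    one_sub_sqrt_le_norm_one_sub_herm a hw
  have hcont : ContinuousOn (fun w => F w * (1 - herm n a w) ^ (-(lam : ℤ))) (UnitBall n) := by
    refine hFc.mul (ContinuousOn.zpow₀ ?_ _ fun w hw => Or.inl ?_)
    · unfold herm
      fun_prop
    · exact norm_pos_iff.1 (hδ0.trans_le (hpos hw))
  have hmeas : AEStronglyMeasurable (fun w => F w * (1 - herm n a w) ^ (-(lam : ℤ)))
      (bergMeasure n lam) :=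
    (hcont.aestronglyMeasurable (isOpen_unitBall n).measurableSet).mono_ac
      (withDensity_absolutelyContinuous _ _)
  refine Integrable.of_bound hmeas (C * (δ ^ lam)⁻¹) ?_
  filter_upwards [ae_bergMeasure_mem n lam] with w hw
  rw [norm_mul, norm_zpow, zpow_neg, zpow_natCast]
  have h1 := hpos hw
  have h2 := hC w hw
  have h3 : 0 ≤ C := (norm_nonneg _).trans h2
  gcongr

/-- The transformation law of the weight under the Möbius action. -/
theorem bergWeight_mob {n lam : ℕ} (hlam : n < lam)
    {h : Matrix (Fin (n + 1)) (Fin (n + 1)) ℂ}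
    (hh : h.conjTranspose * Jmat n * h = Jmat n) {w : Fin n → ℂ} (hw : w ∈ UnitBall n) :
    ((‖dCoc n h w‖ ^ 2) ^ (n + 1))⁻¹ * bergWeight n lam (mob n h w) =
      ((‖dCoc n h w‖ ^ 2) ^ lam)⁻¹ * bergWeight n lam w := by
  obtain ⟨k, rfl⟩ : ∃ k, lam = n + 1 + k := Nat.exists_eq_add_of_lt hlam |>.imp fun k hk => by omega
  have hk : ((n + 1 + k : ℕ) : ℝ) - n - 1 = (k : ℕ) := by push_cast; ring
  have hd : ‖dCoc n h w‖ ≠ 0 := norm_ne_zero_iff.2 (dCoc_ne_zero hh hw)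
  simp only [bergWeight, hk, Real.rpow_natCast, ← norm_dCoc_sq_mul hh hw]
  rw [mul_pow _ _ k, pow_add _ (n + 1) k]
  field_simp

theorem image_mob_unitBall {n : ℕ} {g h : Matrix (Fin (n + 1)) (Fin (n + 1)) ℂ}
    (hg : g.conjTranspose * Jmat n * g = Jmat n) (hh : h.conjTranspose * Jmat n * h = Jmat n)
    (hhg : h * g = 1) : mob n h '' UnitBall n = UnitBall n := by
  refine Set.Subset.antisymm (Set.image_subset_iff.2 fun w hw => mob_mem_unitBall hh hw) ?_
  exact fun w hw => ⟨mob n g w, mob_mem_unitBall hg hw, mob_mob_of_mul_eq_one hhg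
    (dCoc_ne_zero hg hw)⟩

theorem injOn_mob {n : ℕ} {g h : Matrix (Fin (n + 1)) (Fin (n + 1)) ℂ}
    (hh : h.conjTranspose * Jmat n * h = Jmat n) (hgh : g * h = 1) :
    Set.InjOn (mob n h) (UnitBall n) :=
  Set.LeftInvOn.injOn (f₁' := mob n g) fun _ hw =>
    mob_mob_of_mul_eq_one hgh (dCoc_ne_zero hh hw)

theorem hasFDerivWithinAt_mob_real {n : ℕ} {h : Matrix (Fin (n + 1)) (Fin (n + 1)) ℂ}
    (hh : h.conjTranspose * Jmat n * h = Jmat n) {w : Fin n → ℂ} (hw : w ∈ UnitBall n) :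
    HasFDerivWithinAt (mob n h)
      ((Matrix.toLin' (mobJacobian n h w)).toContinuousLinearMap.restrictScalars ℝ)
      (UnitBall n) w :=
  ((hasFDerivAt_mob (dCoc_ne_zero hh hw)).restrictScalars ℝ).hasFDerivWithinAt

theorem abs_det_smul_bergWeight_mob {n lam : ℕ} (hlam : n < lam)
    {h : Matrix (Fin (n + 1)) (Fin (n + 1)) ℂ}
    (hh : h.conjTranspose * Jmat n * h = Jmat n) {w : Fin n → ℂ} (hw : w ∈ UnitBall n) (c : ℂ) :
    |((Matrix.toLin' (mobJacobian n h w)).toContinuousLinearMap.restrictScalars ℝ).det| •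
        (bergWeight n lam (mob n h w) • c) =
      bergWeight n lam w • (((‖dCoc n h w‖ ^ 2) ^ lam)⁻¹ • c) := by
  rw [abs_det_mobJacobian hh hw, smul_smul, bergWeight_mob hlam hh hw, smul_smul, mul_comm]

/-- Change of variables: integrability under `bergMeasure` and the Möbius action. -/
theorem integrable_bergMeasure_iff_mob {n lam : ℕ} (hlam : n < lam)
    {g h : Matrix (Fin (n + 1)) (Fin (n + 1)) ℂ}
    (hg : g.conjTranspose * Jmat n * g = Jmat n) (hh : h.conjTranspose * Jmat n * h = Jmat n)
    (hgh : g * h = 1) (F : (Fin n → ℂ) → ℂ) :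
    Integrable F (bergMeasure n lam) ↔
      Integrable (fun w => ((‖dCoc n h w‖ ^ 2) ^ lam)⁻¹ • F (mob n h w)) (bergMeasure n lam) := by
  have hlam' : (n : ℝ) < lam := by exact_mod_cast hlam
  have hm := (isOpen_unitBall n).measurableSet
  rw [integrable_bergMeasure_iff hlam', integrable_bergMeasure_iff hlam',
    ← image_mob_unitBall hg hh (mul_eq_one_comm.1 hgh),
    integrableOn_image_iff_integrableOn_abs_det_fderiv_smul volume hm
      (fun w hw => hasFDerivWithinAt_mob_real hh hw) (injOn_mob hh hgh),
    image_mob_unitBall hg hh (mul_eq_one_comm.1 hgh)]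
  exact integrableOn_congr_fun (fun w hw => abs_det_smul_bergWeight_mob hlam hh hw _) hm

/-- Change of variables for integrals against `bergMeasure` under the Möbius action. -/
theorem integral_bergMeasure_mob {n lam : ℕ} (hlam : n < lam)
    {g h : Matrix (Fin (n + 1)) (Fin (n + 1)) ℂ}
    (hg : g.conjTranspose * Jmat n * g = Jmat n) (hh : h.conjTranspose * Jmat n * h = Jmat n)
    (hgh : g * h = 1) (F : (Fin n → ℂ) → ℂ) :
    ∫ w, F w ∂(bergMeasure n lam) =
      ∫ w, ((‖dCoc n h w‖ ^ 2) ^ lam)⁻¹ • F (mob n h w) ∂(bergMeasure n lam) := by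
  have hlam' : (n : ℝ) < lam := by exact_mod_cast hlam
  have hm := (isOpen_unitBall n).measurableSet
  rw [integral_bergMeasure hlam', integral_bergMeasure hlam',
    ← image_mob_unitBall hg hh (mul_eq_one_comm.1 hgh),
    integral_image_eq_integral_abs_det_fderiv_smul volume hm
      (fun w hw => hasFDerivWithinAt_mob_real hh hw) (injOn_mob hh hgh),
    image_mob_unitBall hg hh (mul_eq_one_comm.1 hgh)]
  exact setIntegral_congr_fun hm fun w hw => abs_det_smul_bergWeight_mob hlam hh hw _

/-- The transformation law of the reproducing kernel under the Möbius action. -/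
theorem kernel_mob {n : ℕ} (lam : ℕ) {h : Matrix (Fin (n + 1)) (Fin (n + 1)) ℂ}
    (hh : h.conjTranspose * Jmat n * h = Jmat n) {z w : Fin n → ℂ}
    (hz : z ∈ UnitBall n) (hw : w ∈ UnitBall n) :
    dCoc n h z ^ (-(lam : ℤ)) *
        (((‖dCoc n h w‖ ^ 2) ^ lam)⁻¹ •
          (1 - herm n (mob n h z) (mob n h w)) ^ (-(lam : ℤ))) =
      dCoc n h w ^ (-(lam : ℤ)) * (1 - herm n z w) ^ (-(lam : ℤ)) := by
  rw [← dCoc_mul_conj_mul_one_sub_herm hh (dCoc_ne_zero hh hz) (dCoc_ne_zero hh hw),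
    Complex.real_smul]
  push_cast
  rw [← Complex.mul_conj', ← zpow_natCast (_ * _) lam, ← zpow_neg]
  simp only [mul_zpow]
  ring

/-- π_λ(g) ∘ T_φ^{(λ)} = T_{φ_g}^{(λ)} ∘ π_λ(g) for λ ∈ ℕ, λ > n, with both
integrals converging absolutely. -/
theorem piLambda_intertwines_toeplitz
    (n : ℕ) (hn : 1 ≤ n) (lam : ℕ) (hlam : n < lam)
    (g : Matrix (Fin (n + 1)) (Fin (n + 1)) ℂ)
    (hg : g.conjTranspose * Jmat n * g = Jmat n)
    (φ : (Fin n → ℂ) → ℂ)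
    (hφc : ContinuousOn φ (UnitBall n))
    (hφb : ∃ C : ℝ, ∀ z ∈ UnitBall n, ‖φ z‖ ≤ C)
    (f : (Fin n → ℂ) → ℂ)
    (hf : DifferentiableOn ℂ f (UnitBall n))
    (hfb : ∃ C : ℝ, ∀ z ∈ UnitBall n, ‖f z‖ ≤ C) :
    ∀ z ∈ UnitBall n,
      Integrable
        (fun w => φ w * f w * (1 - herm n (mob n g⁻¹ z) w) ^ (-(lam : ℤ)))
        (bergMeasure n lam) ∧
      Integrable
        (fun w => φ (mob n g⁻¹ w) * dCoc n g⁻¹ w ^ (-(lam : ℤ)) * f (mob n g⁻¹ w) *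
          (1 - herm n z w) ^ (-(lam : ℤ)))
        (bergMeasure n lam) ∧
      dCoc n g⁻¹ z ^ (-(lam : ℤ)) *
          ∫ w, φ w * f w * (1 - herm n (mob n g⁻¹ z) w) ^ (-(lam : ℤ))
            ∂(bergMeasure n lam)
        = ∫ w, φ (mob n g⁻¹ w) * dCoc n g⁻¹ w ^ (-(lam : ℤ)) * f (mob n g⁻¹ w) *
            (1 - herm n z w) ^ (-(lam : ℤ)) ∂(bergMeasure n lam) := by
  intro z hz
  have hh := conjTranspose_inv_mul_Jmat hg
  have hgh : g * g⁻¹ = 1 := by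
    refine Matrix.mul_nonsing_inv g (isUnit_iff_ne_zero.2 (norm_ne_zero_iff.1 ?_))
    rw [norm_det_eq_one_of_Jmat hg]
    exact one_ne_zero
  have hb : ∃ C : ℝ, ∀ w ∈ UnitBall n, ‖φ w * f w‖ ≤ C := by
    obtain ⟨C, hC⟩ := hφb
    obtain ⟨D, hD⟩ := hfb
    exact ⟨C * D, fun w hw => norm_mul_le_of_le (hC w hw) (hD w hw)⟩
  have hint := integrable_mul_kernel hlam (hφc.mul hf.continuousOn) hb (mob_mem_unitBall hh hz)
  have hcongr : ∀ᵐ w ∂(bergMeasure n lam),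
      dCoc n g⁻¹ z ^ (-(lam : ℤ)) *
          (((‖dCoc n g⁻¹ w‖ ^ 2) ^ lam)⁻¹ • (φ (mob n g⁻¹ w) * f (mob n g⁻¹ w) *
            (1 - herm n (mob n g⁻¹ z) (mob n g⁻¹ w)) ^ (-(lam : ℤ)))) =
        φ (mob n g⁻¹ w) * dCoc n g⁻¹ w ^ (-(lam : ℤ)) * f (mob n g⁻¹ w) *
          (1 - herm n z w) ^ (-(lam : ℤ)) := by
    filter_upwards [ae_bergMeasure_mem n lam] with w hw
    have hk := kernel_mob lam hh hz hw
    rw [Complex.real_smul] at hk ⊢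
    linear_combination φ (mob n g⁻¹ w) * f (mob n g⁻¹ w) * hk
  refine ⟨hint, ?_, ?_⟩
  · exact (((integrable_bergMeasure_iff_mob hlam hg hh hgh _).1 hint).const_mul _).congr hcongr
  · rw [integral_bergMeasure_mob hlam hg hh hgh, ← integral_const_mul]
    exact integral_congr_ae hcongr
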